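/- arXiv:2208.09326 — 7 statements merged into one kernel-verified Lean document; each statement's English description precedes it below -/
import Mathlib

section
/- Let h φ : ℝ → ℝ satisfy the supporting-line inequality h x ≥ h y + φ y * (x - y) for all x y : ℝ. Then for all y z : ℝ, h y = h z + ∫ t in z..y, φ t (the integral representation of a convex function in terms of a subgradient selection). -/
theorem monotone_of_supporting_line {h φ : ℝ → ℝ}
    (hsupp : ∀ x y : ℝ, h x ≥ h y + φ y * (x - y)) : Monotone φ := by
  intro x y hxy
  rcases hxy.eq_or_lt with rfl | hlt
  · exact le_rfl
  · have h₁ := hsupp x y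
    have h₂ := hsupp y x
    by_contra! hlt'
    nlinarith [mul_pos (sub_pos.2 hlt) (sub_pos.2 hlt')]

theorem convexOn_of_supporting_line {h φ : ℝ → ℝ}
    (hsupp : ∀ x y : ℝ, h x ≥ h y + φ y * (x - y)) : ConvexOn ℝ Set.univ h := by
  refine ⟨convex_univ, fun x _ y _ a b ha hb hab => ?_⟩
  obtain rfl : b = 1 - a := by linarith
  simp only [smul_eq_mul]
  have h₁ := mul_le_mul_of_nonneg_left (hsupp x (a * x + (1 - a) * y)) ha
  have h₂ := mul_le_mul_of_nonneg_left (hsupp y (a * x + (1 - a) * y)) hb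
  linear_combination h₁ + h₂

theorem hasDerivAt_of_supporting_line {h φ : ℝ → ℝ}
    (hsupp : ∀ x y : ℝ, h x ≥ h y + φ y * (x - y)) {y : ℝ} (hφ : ContinuousAt φ y) :
    HasDerivAt h (φ y) y := by
  rw [hasDerivAt_iff_isLittleO, Asymptotics.isLittleO_iff]
  intro c hc
  filter_upwards [Metric.continuousAt_iff'.1 hφ c hc] with x hx
  rw [Real.dist_eq] at hx
  rw [Real.norm_eq_abs, Real.norm_eq_abs, smul_eq_mul]
  have h₁ := hsupp x y
  have h₂ := hsupp y x
  calc |h x - h y - (x - y) * φ y| = h x - h y - (x - y) * φ y :=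
        abs_of_nonneg (by linarith)
    _ ≤ (φ x - φ y) * (x - y) := by linarith
    _ ≤ |(φ x - φ y) * (x - y)| := le_abs_self _
    _ = |φ x - φ y| * |x - y| := abs_mul _ _
    _ ≤ c * |x - y| := by gcongr

/-- Integral representation of a convex function in terms of a subgradient
selection: if `h` satisfies the supporting-line inequality with slope selection
`φ`, then `h y = h z + ∫ t in z..y, φ t` for all `y z`. -/
theorem integral_repr_of_supporting_line (h φ : ℝ → ℝ)
    (hsupp : ∀ x y : ℝ, h x ≥ h y + φ y * (x - y)) :
    ∀ y z : ℝ, h y = h z + ∫ t in z..y, φ t := by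
  intro y z
  have hmono := monotone_of_supporting_line hsupp
  have hcont : ContinuousOn h Set.univ :=
    (convexOn_of_supporting_line hsupp).continuousOn isOpen_univ
  rw [MeasureTheory.integral_eq_of_hasDerivAt_off_countable h φ
    hmono.countable_not_continuousAt (hcont.mono (Set.subset_univ _))
    (fun x hx => hasDerivAt_of_supporting_line hsupp (not_not.1 hx.2))
    hmono.intervalIntegrable]
  ring
end

section
/- If the value-truthfulness condition holds, i.e., for all v v' : ℝ, v * g v - p v ≥ v * g v' - p v', then the allocation g is monotone non-decreasing (Monotone g). (Part 1 of Theorem 1, paper's 'IC implies monotonicity of allocation'.) -/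
/-- Value-truthfulness implies that the allocation `g` is monotone
non-decreasing. -/
theorem allocation_monotone_of_truthful (g p : ℝ → ℝ)
    (htruth : ∀ v v' : ℝ, v * g v - p v ≥ v * g v' - p v') :
    Monotone g := by
  intro a b hab
  rcases hab.eq_or_lt with rfl | hlt
  · exact le_rfl
  · have hprod : 0 ≤ (b - a) * (g b - g a) := by linarith [htruth a b, htruth b a]
    exact sub_nonneg.mp (nonneg_of_mul_nonneg_right hprod (sub_pos.mpr hlt))
end

section
/- If the value-truthfulness condition holds, i.e., for all v v' : ℝ, v * g v - p v ≥ v * g v' - p v', then the agent's utility function u, defined by u v = v * g v - p v, is convex on ℝ (ConvexOn ℝ Set.univ (fun v => v * g v - p v)). -/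
/-- Value-truthfulness implies that the agent's utility
`u v = v * g v - p v` is convex on `ℝ`. -/
theorem utility_convex_of_truthful (g p : ℝ → ℝ)
    (htruth : ∀ v v' : ℝ, v * g v - p v ≥ v * g v' - p v') :
    ConvexOn ℝ Set.univ (fun v => v * g v - p v) := by
  refine ⟨convex_univ, fun x _ y _ a b ha hb hab => ?_⟩
  simp only [smul_eq_mul]
  set w := a * x + b * y with hw
  calc w * g w - p w = a * (x * g w - p w) + b * (y * g w - p w) := by
        linear_combination g w * hw + p w * hab
    _ ≤ a * (x * g x - p x) + b * (y * g y - p y) := by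
        gcongr a * ?_ + b * ?_
        · exact htruth x w
        · exact htruth y w
end

section
/- If the value-truthfulness condition holds, i.e., for all v v' : ℝ, v * g v - p v ≥ v * g v' - p v', then the payment satisfies the Myerson integral formula: for all v : ℝ, p v = p 0 + v * g v - ∫ t in (0:ℝ)..v, g t. (Part 2 of Theorem 1, the payment formula for incentive-compatible diffusion auctions.) -/
/-- A selection of subgradients of a real function is monotone. -/
theorem monotone_of_subgradient {u g : ℝ → ℝ}
    (h : ∀ x y : ℝ, u x + (y - x) * g x ≤ u y) : Monotone g := by
  intro x y hxy
  rcases hxy.eq_or_lt with rfl | hlt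
  · exact le_rfl
  · nlinarith [h x y, h y x]

/-- A real function admitting a subgradient at every point is convex. -/
theorem convexOn_of_subgradient {u g : ℝ → ℝ}
    (h : ∀ x y : ℝ, u x + (y - x) * g x ≤ u y) : ConvexOn ℝ Set.univ u := by
  refine ⟨convex_univ, fun x _ y _ a b ha hb hab => ?_⟩
  simp only [smul_eq_mul]
  set z := a * x + b * y with hz
  have hx := mul_le_mul_of_nonneg_left (h z x) ha
  have hy := mul_le_mul_of_nonneg_left (h z y) hb
  obtain rfl : b = 1 - a := by linarith
  have hsum : a * (u z + (x - z) * g z) + (1 - a) * (u z + (y - z) * g z) = u z := by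
    rw [hz]; ring
  linarith

/-- A function is differentiable wherever a selection of its subgradients is continuous. -/
theorem hasDerivAt_of_subgradient {u g : ℝ → ℝ}
    (h : ∀ x y : ℝ, u x + (y - x) * g x ≤ u y) {x : ℝ} (hg : ContinuousAt g x) :
    HasDerivAt u (g x) x := by
  rw [hasDerivAt_iff_isLittleO, Asymptotics.isLittleO_iff]
  intro c hc
  filter_upwards [Metric.continuousAt_iff'.1 hg c hc] with y hy
  rw [Real.dist_eq] at hy
  rw [smul_eq_mul, Real.norm_eq_abs, Real.norm_eq_abs,
    abs_of_nonneg (by linarith [h x y])]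
  calc u y - u x - (y - x) * g x ≤ (g y - g x) * (y - x) := by linarith [h y x]
    _ ≤ |g y - g x| * |y - x| := (le_abs_self _).trans_eq (abs_mul _ _)
    _ ≤ c * |y - x| := by gcongr

/-- Integrating a selection of subgradients recovers the increments of the function. -/
theorem integral_subgradient {u g : ℝ → ℝ}
    (h : ∀ x y : ℝ, u x + (y - x) * g x ≤ u y) (a b : ℝ) :
    ∫ t in a..b, g t = u b - u a := by
  have hmono := monotone_of_subgradient h
  exact MeasureTheory.integral_eq_of_hasDerivAt_off_countable u g
    hmono.countable_not_continuousAt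
    (((convexOn_of_subgradient h).continuousOn isOpen_univ).mono (Set.subset_univ _))
    (fun x hx => hasDerivAt_of_subgradient h (not_not.1 hx.2))
    hmono.intervalIntegrable


/-- Value-truthfulness implies the Myerson integral payment formula. -/
theorem payment_formula_of_truthful (g p : ℝ → ℝ)
    (htruth : ∀ v v' : ℝ, v * g v - p v ≥ v * g v' - p v') :
    ∀ v : ℝ, p v = p 0 + v * g v - ∫ t in (0:ℝ)..v, g t := by
  intro v
  have h := integral_subgradient (u := fun x => x * g x - p x) (g := g)
    (fun x y => by linarith [htruth y x]) 0 v
  simp only [zero_mul] at h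
  linarith
end

section
/- Suppose g is monotone non-decreasing and the payment satisfies the Myerson integral formula: for all v : ℝ, p v = p 0 + v * g v - ∫ t in (0:ℝ)..v, g t. Then the value-truthfulness condition holds: for all v v' : ℝ, v * g v - p v ≥ v * g v' - p v'. (The value-reporting part of Theorem 2, 'MFF implies DDSIC'.) -/
/-- A monotone function is a subgradient of its integral: the bound holds for both
orders of the endpoints. -/
theorem Monotone.sub_mul_le_intervalIntegral {g : ℝ → ℝ} (hg : Monotone g) (a b : ℝ) :
    (b - a) * g a ≤ ∫ t in a..b, g t := by
  rcases le_total a b with hab | hba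
  · have h := intervalIntegral.integral_mono_on (μ := MeasureTheory.volume) hab
      intervalIntegrable_const
      hg.intervalIntegrable (fun t ht => hg ht.1)
    rwa [intervalIntegral.integral_const, smul_eq_mul] at h
  · have h := intervalIntegral.integral_mono_on (μ := MeasureTheory.volume) hba
      hg.intervalIntegrable
      intervalIntegrable_const (fun t ht => hg ht.2)
    rw [intervalIntegral.integral_const, smul_eq_mul] at h
    rw [intervalIntegral.integral_symm]
    linarith

/-- Monotone allocation together with the Myerson integral payment formula
imply value-truthfulness. -/
theorem truthful_of_monotone_and_payment_formula (g p : ℝ → ℝ)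
    (hmono : Monotone g)
    (hpay : ∀ v : ℝ, p v = p 0 + v * g v - ∫ t in (0:ℝ)..v, g t) :
    ∀ v v' : ℝ, v * g v - p v ≥ v * g v' - p v' := by
  intro v v'
  have hsub := hmono.sub_mul_le_intervalIntegral v' v
  have hadd := intervalIntegral.integral_add_adjacent_intervals
    (hmono.intervalIntegrable (μ := MeasureTheory.volume) (a := 0) (b := v'))
    (hmono.intervalIntegrable (b := v))
  rw [hpay v, hpay v']
  linarith
end

section
/- Virtual valuation identity: Let b : ℝ with 0 < b, let f α : ℝ → ℝ be continuous on the interval [0, b], define F v = ∫ t in (0:ℝ)..v, f t, assume F b = 1, and define pay v = v * α v - ∫ y in (0:ℝ)..v, α y. Then ∫ v in (0:ℝ)..b, pay v * f v = ∫ v in (0:ℝ)..b, α v * (v * f v - (1 - F v)). (Equivalently, the expected payment equals the expectation of the virtual valuation w(v) = v - (1 - F v)/f v times the allocation.) -/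
/-- On the interior of an interval where `g` is continuous, `g` is the derivative of its primitive
based at the left endpoint. -/
theorem ContinuousOn.hasDerivAt_integral_of_mem_Ioo {c d x : ℝ} {g : ℝ → ℝ}
    (hg : ContinuousOn g (Set.Icc c d)) (hx : x ∈ Set.Ioo c d) :
    HasDerivAt (fun u => ∫ t in c..u, g t) (g x) x := by
  refine intervalIntegral.integral_hasDerivAt_right ?_ ?_
    (hg.continuousAt (Icc_mem_nhds hx.1 hx.2))
  · exact (hg.mono (Set.Icc_subset_Icc_right hx.2.le)).intervalIntegrable_of_Icc hx.1.le
  · exact (hg.mono Set.Ioo_subset_Icc_self).stronglyMeasurableAtFilter isOpen_Ioo x hx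

/-- Virtual valuation identity: the expected Myerson payment equals the
expectation of the virtual valuation times the allocation. -/
theorem virtual_valuation_identity (b : ℝ) (hb : 0 < b) (f a : ℝ → ℝ)
    (hf : ContinuousOn f (Set.Icc 0 b)) (ha : ContinuousOn a (Set.Icc 0 b))
    (F pay : ℝ → ℝ)
    (hF : ∀ v : ℝ, F v = ∫ t in (0:ℝ)..v, f t)
    (hFb : F b = 1)
    (hpay : ∀ v : ℝ, pay v = v * a v - ∫ y in (0:ℝ)..v, a y) :
    ∫ v in (0:ℝ)..b, pay v * f v
      = ∫ v in (0:ℝ)..b, a v * (v * f v - (1 - F v)) := by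
  obtain rfl : F = fun v => ∫ t in (0:ℝ)..v, f t := funext hF
  obtain rfl : pay = fun v => v * a v - ∫ y in (0:ℝ)..v, a y := funext hpay
  have hu : Set.uIcc 0 b = Set.Icc 0 b := Set.uIcc_of_le hb.le
  have hfi : IntervalIntegrable f MeasureTheory.volume 0 b := hf.intervalIntegrable_of_Icc hb.le
  have hai : IntervalIntegrable a MeasureTheory.volume 0 b := ha.intervalIntegrable_of_Icc hb.le
  have hFc : ContinuousOn (fun v => ∫ t in (0:ℝ)..v, f t) (Set.Icc 0 b) :=
    hu ▸ intervalIntegral.continuousOn_primitive_interval' hfi Set.left_mem_uIcc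
  have hAc : ContinuousOn (fun v => ∫ t in (0:ℝ)..v, a t) (Set.Icc 0 b) :=
    hu ▸ intervalIntegral.continuousOn_primitive_interval' hai Set.left_mem_uIcc
  have by_parts := intervalIntegral.integral_deriv_mul_eq_sub_of_hasDerivAt
    (a := 0) (b := b) (u := fun v => ∫ t in (0:ℝ)..v, a t) (u' := a)
    (v := fun v => 1 - ∫ t in (0:ℝ)..v, f t) (v' := fun v => -f v)
    (hu ▸ hAc) (hu ▸ continuousOn_const.sub hFc)
    (fun x hx => ha.hasDerivAt_integral_of_mem_Ioo (by simpa [hb.le] using hx))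
    (fun x hx => (hf.hasDerivAt_integral_of_mem_Ioo (by simpa [hb.le] using hx)).const_sub 1)
    hai hfi.neg
  beta_reduce at hFb by_parts ⊢
  rw [hFb, sub_self, mul_zero, intervalIntegral.integral_same, zero_mul, sub_self] at by_parts
  rw [← sub_eq_zero, ← intervalIntegral.integral_sub]
  · exact (intervalIntegral.integral_congr fun v _ => by ring).trans by_parts
  · exact (((continuousOn_id.mul ha).sub hAc).mul hf).intervalIntegrable_of_Icc hb.le
  · exact (ha.mul ((continuousOn_id.mul hf).sub
      (continuousOn_const.sub hFc))).intervalIntegrable_of_Icc hb.le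
end

section
/- Closure of the monotone hazard rate condition under taking maxima of i.i.d. variables (analytic core): Let s : Set ℝ, let F f : ℝ → ℝ, and let n : ℕ with 1 ≤ n. Assume F is monotone non-decreasing on s, 0 < F x and F x < 1 for all x ∈ s, f x ≥ 0 for all x ∈ s, and the hazard rate x ↦ f x / (1 - F x) is monotone non-decreasing on s. Then the function x ↦ (n * (F x)^(n-1) * f x) / (1 - (F x)^n) is monotone non-decreasing on s. (This is the hazard rate of the maximum of n i.i.d. variables with CDF F and density f, since that maximum has CDF F^n and density n F^(n-1) f.) -/
theorem pow_pred_mul_geom_sum_le {a b : ℝ} (ha : 0 ≤ a) (hab : a ≤ b) (n : ℕ) :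
    a ^ (n - 1) * ∑ i ∈ Finset.range n, b ^ i ≤ b ^ (n - 1) * ∑ i ∈ Finset.range n, a ^ i := by
  have hb : 0 ≤ b := ha.trans hab
  rw [Finset.mul_sum, Finset.mul_sum]
  refine Finset.sum_le_sum fun i hi => ?_
  obtain ⟨k, hk⟩ : ∃ k, n - 1 = i + k :=
    Nat.exists_eq_add_of_le (Nat.le_pred_of_lt (Finset.mem_range.1 hi))
  calc a ^ (n - 1) * b ^ i = a ^ i * b ^ i * a ^ k := by rw [hk]; ring
    _ ≤ a ^ i * b ^ i * b ^ k := by gcongr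
    _ = b ^ (n - 1) * a ^ i := by rw [hk]; ring

/-- The hazard rate of the maximum of `n` i.i.d. variables with CDF `F` and
density `f` is monotone non-decreasing on `s` whenever the hazard rate of `F`
is. -/
theorem mhr_of_max_iid (s : Set ℝ) (F f : ℝ → ℝ) (n : ℕ) (hn : 1 ≤ n)
    (hFmono : MonotoneOn F s)
    (hF0 : ∀ x ∈ s, 0 < F x) (hF1 : ∀ x ∈ s, F x < 1)
    (hf : ∀ x ∈ s, f x ≥ 0)
    (hhaz : MonotoneOn (fun x => f x / (1 - F x)) s) :
    MonotoneOn (fun x => ((n : ℝ) * (F x) ^ (n - 1) * f x) / (1 - (F x) ^ n)) s := by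
  have hsum : ∀ x ∈ s, 0 < ∑ i ∈ Finset.range n, F x ^ i := fun x hx =>
    Finset.sum_pos (fun i _ => pow_pos (hF0 x hx) i) (Finset.nonempty_range_iff.2 (by lia))
  have hfactor : ∀ x, (n : ℝ) * F x ^ (n - 1) * f x / (1 - F x ^ n) =
      n * (F x ^ (n - 1) / ∑ i ∈ Finset.range n, F x ^ i) * (f x / (1 - F x)) := by
    intro x
    rw [← geom_sum_mul_neg, ← div_mul_div_comm, mul_div_assoc]
  intro x hx y hy hxy
  simp only [hfactor]
  have hweight : F x ^ (n - 1) / ∑ i ∈ Finset.range n, F x ^ i ≤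
      F y ^ (n - 1) / ∑ i ∈ Finset.range n, F y ^ i :=
    (div_le_div_iff₀ (hsum x hx) (hsum y hy)).2
      (pow_pred_mul_geom_sum_le (hF0 x hx).le (hFmono hx hy hxy) n)
  refine mul_le_mul (mul_le_mul_of_nonneg_left hweight n.cast_nonneg) (hhaz hx hy hxy)
    (div_nonneg (hf x hx) (sub_nonneg.2 (hF1 x hx).le)) ?_
  exact mul_nonneg n.cast_nonneg (div_nonneg (pow_nonneg (hF0 y hy).le _) (hsum y hy).le)
end
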